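/- arXiv:1001.3126 — 12 statements merged into one kernel-verified Lean document; each statement's English description precedes it below -/
import Mathlib

section
/- Let R be a commutative ring, f₁,…,f_s ∈ R, n₁,…,n_s positive integers, and let N be a positive integer divisible by each nᵢ. Then every element of the Rees algebra G = R[f₁·W^{n₁},…,f_s·W^{n_s}] ⊆ R[W] is integral over the R-subalgebra R[I_N·W^N] of R[W] generated by the set {a·W^N : a ∈ I_N}, where I_N is the degree-N part of G. -/
open Polynomial

/-- The Rees algebra `G = R[f₁W^{n₁},…,f_sW^{n_s}] ⊆ R[W]` is integral over
the Rees subring `R[I_N W^N]` whenever `N` is a positive integer divisible by each `nᵢ`. -/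
theorem rees_algebra_integral_over_rees_ring
    {R : Type*} [CommRing R] (s : ℕ) (f : Fin s → R) (n : Fin s → ℕ)
    (hn : ∀ i, 0 < n i) (N : ℕ) (hN : 0 < N) (hdvd : ∀ i, n i ∣ N)
    (G : Subalgebra R R[X])
    (hG : G = Algebra.adjoin R {p : R[X] | ∃ i, p = C (f i) * X ^ n i})
    (I_N : Submodule R R)
    (hI : I_N = Submodule.map (lcoeff R N) G.toSubmodule)
    (A : Subalgebra R R[X])
    (hA : A = Algebra.adjoin R {p : R[X] | ∃ a ∈ I_N, p = C a * X ^ N}) :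
    ∀ g ∈ G, IsIntegral A g := by
  intro g hg
  rw [hG] at hg
  induction hg using Algebra.adjoin_induction with
  | mem p hp =>
    obtain ⟨i, rfl⟩ := hp
    obtain ⟨k, hk⟩ := hdvd i
    have hk0 : 0 < k := by
      rcases Nat.eq_zero_or_pos k with h | h
      · subst h; omega
      · exact h
    have hpow : (C (f i) * X ^ n i : R[X]) ^ k = C (f i ^ k) * X ^ N := by
      rw [mul_pow, ← pow_mul, ← hk, C_pow]
    have hmemG : (C (f i ^ k) * X ^ N : R[X]) ∈ G := by
      rw [← hpow, hG]
      refine pow_mem ?_ k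
      exact Algebra.subset_adjoin ⟨i, rfl⟩
    have hI' : f i ^ k ∈ I_N := by
      rw [hI]
      refine ⟨_, hmemG, ?_⟩
      rw [lcoeff_apply, coeff_C_mul, coeff_X_pow_self, mul_one]
    have hmemA : (C (f i ^ k) * X ^ N : R[X]) ∈ A := by
      rw [hA]
      exact Algebra.subset_adjoin ⟨_, hI', rfl⟩
    refine IsIntegral.of_pow hk0 ?_
    rw [hpow]
    exact isIntegral_algebraMap (R := A) (x := ⟨_, hmemA⟩)
  | algebraMap r =>
    exact isIntegral_algebraMap (R := A) (x := algebraMap R A r)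
  | add x y _ _ hx hy => exact hx.add hy
  | mul x y _ _ hx hy => exact hx.mul hy
end

section
/- Let R be a commutative ring, J an ideal of R, f₁,…,f_s ∈ R, n₁,…,n_s positive integers, and G = R[f₁·W^{n₁},…,f_s·W^{n_s}] ⊆ R[W] with degree parts I_k. Then I_k ⊆ J^k for every k ≥ 1 if and only if fᵢ ∈ J^{nᵢ} for every i = 1,…,s. (This is the pointwise form, at the point corresponding to J, of the statement that the singular locus of a Rees algebra is the intersection of the order-≥nᵢ loci of its generators.) -/
open Polynomial

/-- For the Rees algebra `G = R[f₁W^{n₁},…,f_sW^{n_s}]` with degree parts `I_k`,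
one has `I_k ⊆ J^k` for all `k ≥ 1` iff `fᵢ ∈ J^{nᵢ}` for all `i` (pointwise description of
the singular locus in terms of the generators). -/
theorem sing_locus_iff_generators
    {R : Type*} [CommRing R] (J : Ideal R) (s : ℕ) (f : Fin s → R) (n : Fin s → ℕ)
    (hn : ∀ i, 0 < n i)
    (G : Subalgebra R R[X])
    (hG : G = Algebra.adjoin R {p : R[X] | ∃ i, p = C (f i) * X ^ n i}) :
    (∀ k : ℕ, 1 ≤ k → Submodule.map (lcoeff R k) G.toSubmodule ≤ J ^ k) ↔
      (∀ i, f i ∈ J ^ n i) := by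
  constructor
  · intro h i
    apply h (n i) (hn i)
    refine ⟨C (f i) * X ^ n i, ?_, by simp⟩
    rw [hG]
    exact Algebra.subset_adjoin ⟨i, rfl⟩
  · intro h k _
    have hle : G ≤ reesAlgebra J := by
      rw [hG]
      refine Algebra.adjoin_le ?_
      rintro p ⟨i, rfl⟩
      rw [C_mul_X_pow_eq_monomial]
      exact reesAlgebra.monomial_mem.2 (h i)
    rintro x ⟨p, hp, rfl⟩
    exact (mem_reesAlgebra_iff J p).1 (hle hp) k
end

section
/- Let k be a field, R = k[X₁,…,X_d], and m = (X₁,…,X_d). Let G = R[f₁·W^{n₁},…,f_s·W^{n_s}] and G' = R[g₁·W^{m₁},…,g_t·W^{m_t}] be Rees algebras in R[W] with G ⊆ G' and every element of G' integral over G. If fᵢ ∈ m^{nᵢ} for all i, then gⱼ ∈ m^{mⱼ} for all j. (This is the pointwise form, at the origin, of the statement that integrally equivalent Rees algebras have the same singular locus.) -/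
open Polynomial

lemma aux_mem_iff {k : Type*} [Field k] {d : ℕ} (p : MvPolynomial (Fin d) k) (n : ℕ) :
    p ∈ MvPolynomial.idealOfVars (Fin d) k ^ n ↔ (n : ℕ∞) ≤ (p : MvPowerSeries (Fin d) k).order := by
  rw [MvPolynomial.mem_pow_idealOfVars_iff']
  constructor
  · intro h
    exact MvPowerSeries.nat_le_order fun x hx => by simpa using h x hx
  · intro h x hx
    have := MvPowerSeries.coeff_of_lt_order (f := (p : MvPowerSeries (Fin d) k)) (d := x)
      (lt_of_lt_of_le (by exact_mod_cast hx) h)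
    simpa using this

lemma aux_order_pow {k : Type*} [Field k] {d : ℕ} (p : MvPowerSeries (Fin d) k) (N : ℕ) :
    (p ^ N).order = N * p.order := by
  have := MvPowerSeries.order_prod (fun _ : Fin N => p) Finset.univ
  simpa using this


/-- If `G ⊆ G'` are Rees algebras over `R = k[X₁,…,X_d]` with every element of
`G'` integral over `G`, and the generators of `G` satisfy `fᵢ ∈ 𝔪^{nᵢ}` where `𝔪` is the
irrelevant maximal ideal, then the generators of `G'` satisfy `gⱼ ∈ 𝔪^{mⱼ}` (pointwise form of
the invariance of the singular locus under integral equivalence). -/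
theorem sing_locus_integral_equivalence
    {k : Type*} [Field k] (d : ℕ)
    (s t : ℕ) (f : Fin s → MvPolynomial (Fin d) k) (g : Fin t → MvPolynomial (Fin d) k)
    (n : Fin s → ℕ) (m : Fin t → ℕ) (hn : ∀ i, 0 < n i) (hm : ∀ j, 0 < m j)
    (𝔪 : Ideal (MvPolynomial (Fin d) k))
    (h𝔪 : 𝔪 = Ideal.span (Set.range MvPolynomial.X))
    (G G' : Subalgebra (MvPolynomial (Fin d) k) (MvPolynomial (Fin d) k)[X])
    (hG : G = Algebra.adjoin (MvPolynomial (Fin d) k)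
        {p : (MvPolynomial (Fin d) k)[X] | ∃ i, p = C (f i) * X ^ n i})
    (hG' : G' = Algebra.adjoin (MvPolynomial (Fin d) k)
        {p : (MvPolynomial (Fin d) k)[X] | ∃ j, p = C (g j) * X ^ m j})
    (hsub : G ≤ G')
    (hint : ∀ p ∈ G', IsIntegral G p)
    (hf : ∀ i, f i ∈ 𝔪 ^ n i) :
    ∀ j, g j ∈ 𝔪 ^ m j := by
  intro j
  replace h𝔪 : 𝔪 = MvPolynomial.idealOfVars (Fin d) k := h𝔪
  have hGle : G ≤ reesAlgebra 𝔪 := by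
    rw [hG]
    refine Algebra.adjoin_le ?_
    rintro p ⟨i, rfl⟩
    rw [C_mul_X_pow_eq_monomial]
    exact reesAlgebra.monomial_mem.2 (hf i)
  have hmem : C (g j) * X ^ m j ∈ G' := by
    rw [hG']
    exact Algebra.subset_adjoin ⟨j, rfl⟩
  obtain ⟨P, hP, hev⟩ := hint _ hmem
  rw [eval₂_eq_sum_range, Finset.sum_range_succ] at hev
  set N := P.natDegree with hN
  have hlead : P.coeff N = 1 := hP
  rw [hlead, map_one, one_mul] at hev
  have hc := congrArg (fun q => q.coeff (m j * N)) hev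
  simp only [coeff_add, finsetSum_coeff, coeff_zero, mul_pow, ← C_pow, ← pow_mul] at hc
  rw [coeff_C_mul, coeff_X_pow_self, mul_one] at hc
  by_contra hcon
  rw [h𝔪, aux_mem_iff, not_le] at hcon
  obtain ⟨o, ho⟩ := ENat.ne_top_iff_exists.1 (ne_top_of_lt hcon)
  rw [← ho] at hcon
  have hom : o < m j := by exact_mod_cast hcon
  have hgo : g j ∈ 𝔪 ^ o := by rw [h𝔪, aux_mem_iff, ← ho]
  have hgN : g j ^ N ∈ 𝔪 ^ (N * o + 1) := by
    rw [eq_neg_of_add_eq_zero_right hc]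
    refine neg_mem (sum_mem fun i hi => ?_)
    have hi' : i < N := Finset.mem_range.1 hi
    obtain ⟨e, he⟩ : ∃ e, N = i + e + 1 := ⟨N - i - 1, by omega⟩
    have ha := (mem_reesAlgebra_iff 𝔪 _).1 (hGle (P.coeff i).2) (m j * (e + 1))
    have hsplit : m j * N = m j * (e + 1) + m j * i := by rw [he]; ring
    rw [hsplit, ← mul_assoc, coeff_mul_X_pow, coeff_mul_C]
    have h2 : g j ^ i ∈ 𝔪 ^ (o * i) := by
      rw [pow_mul]; exact Ideal.pow_mem_pow hgo i
    have h3 := Ideal.mul_mem_mul ha h2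
    rw [← pow_add] at h3
    refine Ideal.pow_le_pow_right ?_ h3
    rw [he]
    nlinarith
  rw [h𝔪, aux_mem_iff, MvPolynomial.coe_pow, aux_order_pow, ← ho] at hgN
  have : N * o + 1 ≤ N * o := by exact_mod_cast hgN
  omega
end

section
/- Let k be a field and P = k[Y₁,…,Yₙ,Z] the polynomial ring in n+1 variables. Let the symmetric group Sₙ act on P by permuting the variables Y₁,…,Yₙ and fixing Z and k. Let A be the k-subalgebra of P generated by Z−Y₁,…,Z−Yₙ, and let f = ∏ᵢ₌₁ⁿ (Z−Yᵢ), regarded as a polynomial in Z with coefficients in k[Y₁,…,Yₙ]. Then the set of Sₙ-invariant elements of A equals the k-subalgebra of P generated by the Hasse derivatives {Δ^{(e)}(f) : 0 ≤ e ≤ n−1} (note Δ^{(0)}(f) = f). -/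
open Polynomial

/-- The algebra map sending `Y_i` to `Z - Y_i`. -/
noncomputable def phiAux (k : Type*) [Field k] (n : ℕ) :
    MvPolynomial (Fin n) k →ₐ[k] (MvPolynomial (Fin n) k)[X] :=
  MvPolynomial.aeval (fun i => X - C (MvPolynomial.X i))

theorem phiAux_X {k : Type*} [Field k] {n : ℕ} (i : Fin n) :
    phiAux k n (MvPolynomial.X i) = X - C (MvPolynomial.X i) := by
  simp [phiAux]

theorem phiAux_injective (k : Type*) [Field k] (n : ℕ) : Function.Injective (phiAux k n) := by
  let ψ : (MvPolynomial (Fin n) k)[X] →ₐ[k] MvPolynomial (Fin n) k :=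
    ((Polynomial.aeval (R := MvPolynomial (Fin n) k) (0 : MvPolynomial (Fin n) k))).restrictScalars k
  let ν : MvPolynomial (Fin n) k →ₐ[k] MvPolynomial (Fin n) k :=
    MvPolynomial.aeval (fun i => - MvPolynomial.X i)
  have h : (ν.comp (ψ.comp (phiAux k n))) = AlgHom.id k _ := by
    apply MvPolynomial.algHom_ext
    intro i
    simp [ν, ψ, phiAux_X]
  intro a b hab
  have ha := DFunLike.congr_fun h a
  have hb := DFunLike.congr_fun h b
  simp only [AlgHom.comp_apply, AlgHom.id_apply] at ha hb
  rw [← ha, ← hb, hab]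

theorem phiAux_rename {k : Type*} [Field k] {n : ℕ} (σ : Equiv.Perm (Fin n))
    (q : MvPolynomial (Fin n) k) :
    Polynomial.map (MvPolynomial.rename (⇑σ)).toRingHom (phiAux k n q) =
      phiAux k n (MvPolynomial.rename σ q) := by
  have h : (Polynomial.mapAlgHom (MvPolynomial.rename (R := k) (⇑σ))).comp (phiAux k n) =
      (phiAux k n).comp (MvPolynomial.rename σ) := by
    apply MvPolynomial.algHom_ext
    intro i
    simp [phiAux_X]
  exact DFunLike.congr_fun h q

theorem phiAux_esymm {k : Type*} [Field k] {n : ℕ} (e : ℕ) (he : e ≤ n) :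
    phiAux k n (MvPolynomial.esymm (Fin n) k (n - e)) =
      hasseDeriv e (∏ i : Fin n, (X - C (MvPolynomial.X i)) : (MvPolynomial (Fin n) k)[X]) := by
  set f := (∏ i : Fin n, (X - C (MvPolynomial.X i)) : (MvPolynomial (Fin n) k)[X]) with hf
  have h1 := taylor_coeff (X : (MvPolynomial (Fin n) k)[X]) (f.map C) e
  have h2 : (hasseDeriv e (f.map C)).eval (X : (MvPolynomial (Fin n) k)[X]) = hasseDeriv e f := by
    have hm : hasseDeriv e (f.map C) = (hasseDeriv e f).map C := by
      ext1 j
      simp [hasseDeriv_coeff]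
    rw [hm, Polynomial.eval_map]
    exact eval₂_C_X
  have h3 : taylor (X : (MvPolynomial (Fin n) k)[X]) (f.map C) =
      ∏ i : Fin n, (X + C (X - C (MvPolynomial.X i))) := by
    rw [hf, Polynomial.map_prod, taylor_apply, Polynomial.prod_comp]
    refine Finset.prod_congr rfl fun i _ => ?_
    simp
    ring
  rw [← h2, ← h1, h3, Finset.prod_X_add_C_coeff _ _ (by simpa using he)]
  simp [MvPolynomial.esymm, map_sum, map_prod, phiAux_X]

/-- In `P = k[Y₁,…,Yₙ][Z]`, with `Sₙ` acting by permuting the `Yᵢ` and fixing `Z`,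
the invariant elements of the subalgebra `A = k[Z-Y₁,…,Z-Yₙ]` form exactly the `k`-subalgebra
generated by the Hasse derivatives `Δ^{(e)}(f)`, `0 ≤ e ≤ n-1`, of `f = ∏ᵢ (Z - Yᵢ)`. -/
theorem invariants_of_linear_forms_eq_adjoin_hasseDeriv
    {k : Type*} [Field k] (n : ℕ)
    (A : Subalgebra k (MvPolynomial (Fin n) k)[X])
    (hA : A = Algebra.adjoin k
        {p : (MvPolynomial (Fin n) k)[X] | ∃ i : Fin n, p = X - C (MvPolynomial.X i)})
    (f : (MvPolynomial (Fin n) k)[X])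
    (hf : f = ∏ i : Fin n, (X - C (MvPolynomial.X i))) :
    {p : (MvPolynomial (Fin n) k)[X] | p ∈ A ∧
        ∀ σ : Equiv.Perm (Fin n),
          Polynomial.map (MvPolynomial.rename (⇑σ)).toRingHom p = p} =
      (Algebra.adjoin k
        {q : (MvPolynomial (Fin n) k)[X] | ∃ e < n, q = hasseDeriv e f} : Set _) := by
  subst hA hf
  have hA : Algebra.adjoin k
        {p : (MvPolynomial (Fin n) k)[X] | ∃ i : Fin n, p = X - C (MvPolynomial.X i)} =
      (phiAux k n).range := by
    rw [phiAux, ← Algebra.adjoin_range_eq_range_aeval]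
    congr 1
    ext p
    simp [eq_comm]
  rw [hA]
  ext p
  simp only [Set.mem_ofPred_eq, SetLike.mem_coe]
  constructor
  · rintro ⟨⟨q, rfl⟩, hq⟩
    have hs : q.IsSymmetric := by
      intro σ
      apply phiAux_injective k n
      rw [← phiAux_rename]
      exact hq σ
    obtain ⟨r, hr⟩ := MvPolynomial.esymmAlgHom_surjective (σ := Fin n) (n := n) k (by simp) ⟨q, hs⟩
    have hr' := congrArg Subtype.val hr
    rw [MvPolynomial.esymmAlgHom_apply] at hr'
    simp only at hr'
    rw [← hr']
    change phiAux k n _ ∈ _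
    have hmem : MvPolynomial.aeval (fun i : Fin n => MvPolynomial.esymm (Fin n) k (i + 1)) r ∈
        Algebra.adjoin k (Set.range (fun i : Fin n => MvPolynomial.esymm (Fin n) k (i + 1))) := by
      rw [Algebra.adjoin_range_eq_range_aeval]
      exact ⟨r, rfl⟩
    have hle : Algebra.adjoin k (Set.range (fun i : Fin n => MvPolynomial.esymm (Fin n) k (i + 1)))
        ≤ (Algebra.adjoin k {q : (MvPolynomial (Fin n) k)[X] | ∃ e < n,
            q = hasseDeriv e (∏ i : Fin n, (X - C (MvPolynomial.X i)))}).comap (phiAux k n) := by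
      apply Algebra.adjoin_le
      rintro _ ⟨i, rfl⟩
      apply Algebra.subset_adjoin
      refine ⟨n - (i + 1), by omega, ?_⟩
      rw [← phiAux_esymm _ (by omega)]
      have hi : n - (n - ((i : ℕ) + 1)) = (i : ℕ) + 1 := by omega
      rw [hi]
      rfl
    exact hle hmem
  · intro hp
    have hle : Algebra.adjoin k {q : (MvPolynomial (Fin n) k)[X] | ∃ e < n,
            q = hasseDeriv e (∏ i : Fin n, (X - C (MvPolynomial.X i)))} ≤
        (MvPolynomial.symmetricSubalgebra (Fin n) k).map (phiAux k n) := by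
      apply Algebra.adjoin_le
      rintro _ ⟨e, he, rfl⟩
      rw [← phiAux_esymm _ he.le]
      exact ⟨_, MvPolynomial.esymm_isSymmetric _ _ _, rfl⟩
    obtain ⟨q, hq, rfl⟩ := hle hp
    refine ⟨⟨q, rfl⟩, fun σ => ?_⟩
    have := phiAux_rename σ q
    rw [hq σ] at this
    exact this
end

section
/- Let k be a field, n = r + s with r,s ≥ 1, and P = k[Y₁,…,Yₙ,Z]. Let the group S_r × S_s act on P by permuting the variables Y₁,…,Y_r among themselves and Y_{r+1},…,Yₙ among themselves, fixing Z and k. Let A be the k-subalgebra of P generated by Z−Y₁,…,Z−Yₙ, and set g = ∏ᵢ₌₁^r (Z−Yᵢ) and h = ∏ᵢ₌ᵣ₊₁ⁿ (Z−Yᵢ), regarded as polynomials in Z with coefficients in k[Y₁,…,Yₙ]. Then the set of (S_r × S_s)-invariant elements of A equals the k-subalgebra of P generated by {Δ^{(e)}(g) : 0 ≤ e ≤ r−1} ∪ {Δ^{(ℓ)}(h) : 0 ≤ ℓ ≤ s−1}. -/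
open Polynomial

theorem aux_hmap {R S : Type*} [CommRing R] [CommRing S] (f : R →+* S) (e : ℕ) (p : R[X]) :
    hasseDeriv e (p.map f) = (hasseDeriv e p).map f := by
  ext1 m
  simp only [hasseDeriv_coeff, coeff_map, map_mul, map_natCast]

theorem aux_hasse {k R ι : Type*} [CommRing k] [CommRing R] [Algebra k R] [Fintype ι] (y : ι → R)
    (n e : ℕ) (hn : Fintype.card ι = n) (he : e ≤ n) :
    hasseDeriv e (∏ i, (X - C (y i))) =
      MvPolynomial.aeval (fun i => (X - C (y i) : R[X])) (MvPolynomial.esymm ι k (n - e)) := by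
  have h1 : hasseDeriv e (∏ i, (X - C (y i))) =
      (taylor (X : R[X]) ((∏ i, (X - C (y i))).map C)).coeff e := by
    rw [taylor_coeff, aux_hmap, eval_map, eval₂_C_X]
  have h2 : taylor (X : R[X]) ((∏ i, (X - C (y i))).map C) = ∏ i, (X + C (X - C (y i))) := by
    rw [Polynomial.map_prod, ← taylorAlgHom_apply, map_prod]
    refine Finset.prod_congr rfl fun i _ => ?_
    simp [taylorAlgHom_apply]
    ring
  rw [h1, h2, Finset.prod_X_add_C_coeff _ _ (by simpa [hn] using he)]
  simp [MvPolynomial.esymm, hn, map_sum, map_prod]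

theorem aux_aeval_mem {k B S ι : Type*} [CommRing k] [CommRing B] [CommRing S] [Algebra k S]
    (D : Subalgebra k S) (f : B →+* S) (x : ι → S) (q : MvPolynomial ι B)
    (hx : ∀ i, x i ∈ D) (hq : ∀ d, f (q.coeff d) ∈ D) : MvPolynomial.eval₂ f x q ∈ D := by
  rw [MvPolynomial.eval₂_eq]
  exact D.sum_mem fun d _ => D.mul_mem (hq d) (D.prod_mem fun i _ => D.pow_mem (hx i) _)

theorem aux_sym {k B S : Type*} [CommRing k] [CommRing B] [CommRing S] [Algebra k S] (n : ℕ)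
    (D : Subalgebra k S) (f : MvPolynomial (Fin n) B →+* S)
    (q : MvPolynomial (Fin n) B)
    (hx : ∀ i : Fin n, f (MvPolynomial.esymm (Fin n) B (i + 1)) ∈ D)
    (hq : ∀ d, f (MvPolynomial.C (q.coeff d)) ∈ D) :
    f (MvPolynomial.esymmAlgHom (Fin n) B n q : MvPolynomial (Fin n) B) ∈ D := by
  rw [MvPolynomial.esymmAlgHom_apply, MvPolynomial.aeval_def, MvPolynomial.hom_eval₂]
  exact aux_aeval_mem D _ _ q hx (fun d => hq d)

theorem aux_double {k : Type*} [CommRing k] (r s : ℕ)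
    (D : Subalgebra k (MvPolynomial (Fin r ⊕ Fin s) k))
    (hl : ∀ i : Fin r, MvPolynomial.rename Sum.inl (MvPolynomial.esymm (Fin r) k (i + 1)) ∈ D)
    (hr : ∀ i : Fin s, MvPolynomial.rename Sum.inr (MvPolynomial.esymm (Fin s) k (i + 1)) ∈ D)
    (f : MvPolynomial (Fin r ⊕ Fin s) k)
    (hf : ∀ σ : Equiv.Perm (Fin r) × Equiv.Perm (Fin s),
      MvPolynomial.rename (⇑(Equiv.sumCongr σ.1 σ.2)) f = f) : f ∈ D := by
  set E := MvPolynomial.sumAlgEquiv k (Fin r) (Fin s) with hE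
  have e1 : ∀ (σ : Equiv.Perm (Fin r)) p, E (MvPolynomial.rename (⇑(Equiv.sumCongr σ 1)) p) =
      MvPolynomial.rename σ (E p) := by
    intro σ p
    have : E.toAlgHom.comp (MvPolynomial.rename (⇑(Equiv.sumCongr σ 1))) =
        ((MvPolynomial.rename σ : _ →ₐ[MvPolynomial (Fin s) k] _).restrictScalars k).comp
          E.toAlgHom := by
      ext i
      cases i <;> simp [hE]
    exact DFunLike.congr_fun this p
  have e2 : ∀ (τ : Equiv.Perm (Fin s)) p, E (MvPolynomial.rename (⇑(Equiv.sumCongr 1 τ)) p) =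
      MvPolynomial.map (MvPolynomial.rename τ : _ →ₐ[k] _).toRingHom (E p) := by
    intro τ p
    have : E.toAlgHom.comp (MvPolynomial.rename (⇑(Equiv.sumCongr 1 τ))) =
        (MvPolynomial.mapAlgHom (MvPolynomial.rename τ : _ →ₐ[k] _)).comp
          E.toAlgHom := by
      ext i
      cases i <;> simp [hE]
    exact DFunLike.congr_fun this p
  have hsym : (E f).IsSymmetric := fun σ => by rw [← e1, hf (σ, 1)]
  obtain ⟨q, hq⟩ := MvPolynomial.esymmAlgHom_surjective (σ := Fin r) (MvPolynomial (Fin s) k)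
    (n := r) (by simp) ⟨E f, hsym⟩
  have hq' : (MvPolynomial.esymmAlgHom (Fin r) (MvPolynomial (Fin s) k) r q :
    MvPolynomial (Fin r) (MvPolynomial (Fin s) k)) = E f := by rw [hq]
  have hqs : ∀ d, (q.coeff d).IsSymmetric := by
    intro d τ
    have : MvPolynomial.map (MvPolynomial.rename τ : _ →ₐ[k] _).toRingHom q = q := by
      apply MvPolynomial.esymmAlgHom_injective (σ := Fin r) (MvPolynomial (Fin s) k)
        (n := r) (by simp)
      apply Subtype.ext
      rw [hq', ← hf (1, τ), e2, ← hq', MvPolynomial.esymmAlgHom_apply,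
        MvPolynomial.esymmAlgHom_apply, MvPolynomial.aeval_def, MvPolynomial.aeval_def,
        MvPolynomial.hom_eval₂, MvPolynomial.eval₂_map]
      congr 1
      · ext <;> simp
      · funext i
        simp [MvPolynomial.map_esymm]
    conv_rhs => rw [← this]
    rw [MvPolynomial.coeff_map]
    rfl
  have hEl : ∀ p : MvPolynomial (Fin r) k, E (MvPolynomial.rename Sum.inl p) =
      MvPolynomial.map MvPolynomial.C p := by
    intro p
    have : E.toAlgHom.comp (MvPolynomial.rename Sum.inl) =
        MvPolynomial.mapAlgHom (Algebra.ofId k (MvPolynomial (Fin s) k)) := by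
      ext i
      simp [hE]
    exact DFunLike.congr_fun this p
  have hEr : ∀ p : MvPolynomial (Fin s) k, E (MvPolynomial.rename Sum.inr p) =
      MvPolynomial.C p := by
    intro p
    have : E.toAlgHom.comp (MvPolynomial.rename Sum.inr) =
        IsScalarTower.toAlgHom k (MvPolynomial (Fin s) k) _ := by
      ext i
      simp [hE]
    exact DFunLike.congr_fun this p
  rw [← E.symm_apply_apply f, ← hq']
  refine aux_sym r D E.symm.toAlgHom.toRingHom q ?_ ?_
  · intro i
    have := hl i
    rw [← E.symm_apply_apply (MvPolynomial.rename Sum.inl _), hEl, MvPolynomial.map_esymm] at this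
    exact this
  · intro d
    have h1 : E.symm.toAlgHom.toRingHom (MvPolynomial.C (q.coeff d)) =
        MvPolynomial.rename Sum.inr (q.coeff d) := by
      rw [← hEr]; exact E.symm_apply_apply _
    rw [h1]
    obtain ⟨q', hq2⟩ := MvPolynomial.esymmAlgHom_surjective (σ := Fin s) k
      (n := s) (by simp) ⟨q.coeff d, hqs d⟩
    have hq3 : (MvPolynomial.esymmAlgHom (Fin s) k s q' : MvPolynomial (Fin s) k) = q.coeff d := by
      rw [hq2]
    rw [← hq3]
    refine aux_sym s D (MvPolynomial.rename Sum.inr : _ →ₐ[k] _).toRingHom q' hr ?_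
    intro d'
    have : (MvPolynomial.rename Sum.inr : _ →ₐ[k] MvPolynomial (Fin r ⊕ Fin s) k).toRingHom
      (MvPolynomial.C (q'.coeff d')) = algebraMap k _ (q'.coeff d') :=
        MvPolynomial.rename_C _ _
    rw [this]
    exact D.algebraMap_mem _

/-- In `P = k[Y₁,…,Yₙ][Z]` with `n = r + s` (variables indexed by `Fin r ⊕ Fin s`),
with `S_r × S_s` acting by permuting the first `r` and the last `s` of the `Y`-variables
separately and fixing `Z`, the invariant elements of `A = k[Z-Y₁,…,Z-Yₙ]` form exactly the
`k`-subalgebra generated by the Hasse derivatives `Δ^{(e)}(g)`, `0 ≤ e ≤ r-1`, and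
`Δ^{(ℓ)}(h)`, `0 ≤ ℓ ≤ s-1`, of `g = ∏_{i≤r} (Z-Yᵢ)` and `h = ∏_{i>r} (Z-Yᵢ)`. -/
theorem invariants_two_groups_eq_adjoin_hasseDerivs
    {k : Type*} [Field k] (r s : ℕ) (hr : 1 ≤ r) (hs : 1 ≤ s)
    (A : Subalgebra k (MvPolynomial (Fin r ⊕ Fin s) k)[X])
    (hA : A = Algebra.adjoin k
        {p : (MvPolynomial (Fin r ⊕ Fin s) k)[X] |
          ∃ v : Fin r ⊕ Fin s, p = X - C (MvPolynomial.X v)})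
    (g h : (MvPolynomial (Fin r ⊕ Fin s) k)[X])
    (hg : g = ∏ i : Fin r, (X - C (MvPolynomial.X (Sum.inl i))))
    (hh : h = ∏ j : Fin s, (X - C (MvPolynomial.X (Sum.inr j)))) :
    {p : (MvPolynomial (Fin r ⊕ Fin s) k)[X] | p ∈ A ∧
        ∀ σ : Equiv.Perm (Fin r) × Equiv.Perm (Fin s),
          Polynomial.map (MvPolynomial.rename (⇑(Equiv.sumCongr σ.1 σ.2))).toRingHom p = p} =
      (Algebra.adjoin k
        ({q : (MvPolynomial (Fin r ⊕ Fin s) k)[X] | ∃ e < r, q = hasseDeriv e g} ∪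
         {q : (MvPolynomial (Fin r ⊕ Fin s) k)[X] | ∃ l < s, q = hasseDeriv l h}) : Set _) := by
  set φ : MvPolynomial (Fin r ⊕ Fin s) k →ₐ[k] (MvPolynomial (Fin r ⊕ Fin s) k)[X] :=
    MvPolynomial.aeval (fun v => X - C (MvPolynomial.X v)) with hφ
  have hAφ : A = φ.range := by
    rw [hA, hφ, ← Algebra.adjoin_range_eq_range_aeval]
    congr 1
    ext p
    simp [eq_comm]
  have hinj : Function.Injective φ := by
    have h0 : ((MvPolynomial.aeval (fun v => -MvPolynomial.X v) :
        MvPolynomial (Fin r ⊕ Fin s) k →ₐ[k] MvPolynomial (Fin r ⊕ Fin s) k).comp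
        (((Polynomial.aeval (0 : MvPolynomial (Fin r ⊕ Fin s) k)).restrictScalars k).comp φ)) =
        AlgHom.id k _ := by
      ext v
      simp [hφ]
    intro a b hab
    have ha := DFunLike.congr_fun h0 a
    have hb := DFunLike.congr_fun h0 b
    simp only [AlgHom.comp_apply, AlgHom.id_apply] at ha hb
    rw [← ha, ← hb, hab]
  have heq : ∀ (e : Equiv.Perm (Fin r ⊕ Fin s)) p,
      Polynomial.map (MvPolynomial.rename e : _ →ₐ[k] _).toRingHom (φ p) =
      φ (MvPolynomial.rename e p) := by
    intro e p
    have : (Polynomial.mapAlgHom (MvPolynomial.rename e : _ →ₐ[k] _)).comp φ =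
        φ.comp (MvPolynomial.rename e) := by
      ext1 v
      simp [hφ]
    exact DFunLike.congr_fun this p
  have hgφ : ∀ e ≤ r, hasseDeriv e g =
      φ (MvPolynomial.rename Sum.inl (MvPolynomial.esymm (Fin r) k (r - e))) := by
    intro e he
    rw [hg, aux_hasse (k := k) _ r e (by simp) he, hφ, MvPolynomial.aeval_rename]
    rfl
  have hhφ : ∀ e ≤ s, hasseDeriv e h =
      φ (MvPolynomial.rename Sum.inr (MvPolynomial.esymm (Fin s) k (s - e))) := by
    intro e he
    rw [hh, aux_hasse (k := k) _ s e (by simp) he, hφ, MvPolynomial.aeval_rename]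
    rfl
  apply Set.Subset.antisymm
  · rintro p ⟨hpA, hp⟩
    rw [hAφ] at hpA
    obtain ⟨f, rfl⟩ := hpA
    refine aux_double r s (Subalgebra.comap φ (Algebra.adjoin k _)) ?_ ?_ f ?_
    · intro i
      refine Algebra.subset_adjoin (Or.inl ⟨r - (i + 1), by omega, ?_⟩)
      rw [hgφ _ (by omega), show r - (r - ((i : ℕ) + 1)) = i + 1 by omega]
      rfl
    · intro i
      refine Algebra.subset_adjoin (Or.inr ⟨s - (i + 1), by omega, ?_⟩)
      rw [hhφ _ (by omega), show s - (s - ((i : ℕ) + 1)) = i + 1 by omega]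
      rfl
    · intro σ
      apply hinj
      rw [← heq]
      exact hp σ
  · intro p hp
    have key : ∀ x ∈ ({q : (MvPolynomial (Fin r ⊕ Fin s) k)[X] | ∃ e < r, q = hasseDeriv e g} ∪
         {q : (MvPolynomial (Fin r ⊕ Fin s) k)[X] | ∃ l < s, q = hasseDeriv l h}),
        x ∈ A ∧ ∀ σ : Equiv.Perm (Fin r) × Equiv.Perm (Fin s),
          Polynomial.map (MvPolynomial.rename (⇑(Equiv.sumCongr σ.1 σ.2))).toRingHom x = x := by
      rintro x (⟨e, he, rfl⟩ | ⟨e, he, rfl⟩)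
      · rw [hgφ e he.le, hAφ]
        refine ⟨⟨_, rfl⟩, fun σ => ?_⟩
        rw [heq, MvPolynomial.rename_rename]
        conv_rhs => rw [← MvPolynomial.rename_esymm (Fin r) k (r - e) σ.1,
          MvPolynomial.rename_rename]
        rfl
      · rw [hhφ e he.le, hAφ]
        refine ⟨⟨_, rfl⟩, fun σ => ?_⟩
        rw [heq, MvPolynomial.rename_rename]
        conv_rhs => rw [← MvPolynomial.rename_esymm (Fin s) k (s - e) σ.2,
          MvPolynomial.rename_rename]
        rfl
    refine ⟨?_, fun σ => ?_⟩
    · exact Algebra.adjoin_le (fun x hx => (key x hx).1) hp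
    · have := Algebra.adjoin_le (S := AlgHom.equalizer (Polynomial.mapAlgHom
        (MvPolynomial.rename (⇑(Equiv.sumCongr σ.1 σ.2)) : _ →ₐ[k] _)) (AlgHom.id k _))
        (fun x hx => (key x hx).2 σ) hp
      exact this
end

section
/- Let S be a commutative ring and let g, h ∈ S[Z] be monic polynomials of degrees r ≥ 1 and s ≥ 1 respectively; set f = g·h, a monic polynomial of degree n = r + s. Work in the polynomial ring S[Z][W]. Then every element of the S[Z]-subalgebra of S[Z][W] generated by {g·W^r} ∪ {Δ^{(e)}(g)·W^{r−e} : 1 ≤ e ≤ r−1} ∪ {h·W^s} ∪ {Δ^{(ℓ)}(h)·W^{s−ℓ} : 1 ≤ ℓ ≤ s−1} is integral over the S[Z]-subalgebra generated by {f·W^n} ∪ {Δ^{(j)}(f)·W^{n−j} : 1 ≤ j ≤ n−1}. -/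
open Polynomial

set_option synthInstance.maxHeartbeats 1000000

/-- The homogenised Taylor expansion `W^r g(Z + T/W)`. -/
noncomputable def tayScale {S : Type*} [CommRing S] (g : S[X]) : S[X][X][X] :=
  scaleRoots ((taylor (X : S[X]) (g.map C)).map C) X

lemma taylor_monic_aux {R : Type*} [CommRing R] (a : R) (q : R[X]) (hq : q.Monic) :
    (taylor a q).Monic := by
  rw [Monic, leadingCoeff_taylor, hq.leadingCoeff]

lemma tayScale_monic {S : Type*} [CommRing S] (g : S[X]) (hg : g.Monic) :
    (tayScale g).Monic := by
  rw [tayScale, monic_scaleRoots_iff]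
  exact (taylor_monic_aux _ _ (hg.map C)).map C

lemma tayScale_natDegree {S : Type*} [CommRing S] [Nontrivial S] (g : S[X]) :
    (tayScale g).natDegree = g.natDegree := by
  rw [tayScale, natDegree_scaleRoots, natDegree_map_eq_of_injective C_injective, natDegree_taylor,
    natDegree_map_eq_of_injective C_injective]

lemma tayScale_coeff {S : Type*} [CommRing S] (g : S[X]) (e : ℕ) :
    (tayScale g).coeff e = C (hasseDeriv e g) * X ^ (g.natDegree - e) := by
  rw [tayScale, coeff_scaleRoots, coeff_map, taylor_coeff,
    natDegree_map_eq_of_injective C_injective, natDegree_taylor,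
    natDegree_map_eq_of_injective C_injective]
  have : hasseDeriv e (g.map C) = (hasseDeriv e g).map C := by
    ext1 k
    simp [hasseDeriv_coeff]
  rw [this, eval_map, eval₂_C_X]

lemma tayScale_mul {S : Type*} [CommRing S] [Nontrivial S] (g h : S[X]) (hg : g.Monic)
    (hh : h.Monic) : tayScale (g * h) = tayScale g * tayScale h := by
  have h1 := (taylor_monic_aux (X : S[X]) _ (hg.map C)).map (C (R := S[X]))
  have h2 := (taylor_monic_aux (X : S[X]) _ (hh.map C)).map (C (R := S[X]))
  rw [tayScale, Polynomial.map_mul, taylor_mul, Polynomial.map_mul, mul_scaleRoots']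
  · rfl
  · rw [h1.leadingCoeff, h2.leadingCoeff]; simp

/-- If `f = g·h` is a product of monic polynomials of degrees `r, s ≥ 1` in `S[Z]`,
`n = r + s`, then in `S[Z][W]` the `S[Z]`-algebra generated by
`g·W^r, Δ^{(e)}(g)·W^{r-e} (1 ≤ e ≤ r-1), h·W^s, Δ^{(ℓ)}(h)·W^{s-ℓ} (1 ≤ ℓ ≤ s-1)` is integral
over the `S[Z]`-algebra generated by `f·W^n, Δ^{(j)}(f)·W^{n-j} (1 ≤ j ≤ n-1)`. -/
theorem factored_algebra_integral_over_product_algebra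
    {S : Type*} [CommRing S] (r s : ℕ) (hr : 1 ≤ r) (hs : 1 ≤ s)
    (g h : S[X]) (hg : g.Monic) (hh : h.Monic)
    (hgd : g.natDegree = r) (hhd : h.natDegree = s)
    (f : S[X]) (hf : f = g * h) (n : ℕ) (hn : n = r + s)
    (A B : Subalgebra S[X] S[X][X])
    (hA : A = Algebra.adjoin S[X]
        (({C g * X ^ r} ∪
          {q : S[X][X] | ∃ e, 1 ≤ e ∧ e ≤ r - 1 ∧ q = C (hasseDeriv e g) * X ^ (r - e)} ∪
          {C h * X ^ s} ∪
          {q : S[X][X] | ∃ l, 1 ≤ l ∧ l ≤ s - 1 ∧ q = C (hasseDeriv l h) * X ^ (s - l)}) :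
          Set S[X][X]))
    (hB : B = Algebra.adjoin S[X]
        (({C f * X ^ n} ∪
          {q : S[X][X] | ∃ j, 1 ≤ j ∧ j ≤ n - 1 ∧ q = C (hasseDeriv j f) * X ^ (n - j)}) :
          Set S[X][X])) :
    ∀ p ∈ A, IsIntegral B p := by
  nontriviality S
  have hfm : f.Monic := hf ▸ hg.mul hh
  have hfd : f.natDegree = n := by rw [hf, hg.natDegree_mul hh, hgd, hhd, hn]
  have hlift : tayScale f ∈ lifts (algebraMap B S[X][X]) := by
    rw [lifts_iff_coeff_lifts]
    intro j
    suffices (tayScale f).coeff j ∈ B from ⟨⟨_, this⟩, rfl⟩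
    rw [tayScale_coeff, hfd]
    rcases lt_trichotomy j n with hj | hj | hj
    · rw [hB]
      apply Algebra.subset_adjoin
      rcases Nat.eq_zero_or_pos j with rfl | h0
      · left; simp
      · right; exact ⟨j, h0, by omega, rfl⟩
    · subst hj
      rw [← hfd, hasseDeriv_natDegree_eq_C, hfm.leadingCoeff]
      simp
    · rw [hasseDeriv_eq_zero_of_lt_natDegree _ _ (by omega)]
      simp
  obtain ⟨P, hP, -, hPm⟩ := lifts_and_natDegree_eq_and_monic hlift (tayScale_monic f hfm)
  have key : ∀ q : S[X], q.Monic → tayScale q ∣ tayScale f → ∀ i,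
      IsIntegral B (C (hasseDeriv i q) * X ^ (q.natDegree - i)) := by
    intro q hq hd i
    rw [← tayScale_coeff]
    exact isIntegral_coeff_of_dvd P _ hPm (tayScale_monic q hq) (hP ▸ hd) i
  have hmul : tayScale f = tayScale g * tayScale h := hf ▸ tayScale_mul g h hg hh
  have kg := key g hg ⟨_, hmul⟩
  have kh := key h hh ⟨tayScale g, by rw [hf, mul_comm g h]; exact tayScale_mul h g hh hg⟩
  rw [hgd] at kg
  rw [hhd] at kh
  intro p hp
  rw [hA] at hp
  induction hp using Algebra.adjoin_induction with
  | mem x hx =>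
    rcases hx with ((hx | ⟨e, -, -, rfl⟩) | hx) | ⟨e, -, -, rfl⟩
    · rw [Set.mem_singleton_iff.mp hx]; simpa using kg 0
    · exact kg e
    · rw [Set.mem_singleton_iff.mp hx]; simpa using kh 0
    · exact kh e
  | algebraMap a => exact isIntegral_algebraMap (R := B) (x := algebraMap S[X] B a)
  | add x y _ _ hx hy => exact hx.add hy
  | mul x y _ _ hx hy => exact hx.mul hy
end

section
/- Let k be a field, R = k[X₁,…,X_d], m = (X₁,…,X_d), and let f₁,…,f_s ∈ R and positive integers n₁,…,n_s satisfy fᵢ ∈ m^{nᵢ} for all i. Let G = R[f₁·W^{n₁},…,f_s·W^{n_s}] ⊆ R[W] with degree parts I_k (so that I_k ⊆ m^k for all k ≥ 1). Then the ideal of R generated by the initial forms {In_k(h) : k ≥ 1, h ∈ I_k} equals the ideal generated by the initial forms of the generators, {In_{n₁}(f₁),…,In_{n_s}(f_s)}. -/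
open Polynomial

theorem hc_mul_aux {σ k : Type*} [Field k] {a b : ℕ} {h g : MvPolynomial σ k}
    (hh : h ∈ MvPolynomial.idealOfVars σ k ^ a) (hg : g ∈ MvPolynomial.idealOfVars σ k ^ b) :
    MvPolynomial.homogeneousComponent (a + b) (h * g) =
      MvPolynomial.homogeneousComponent a h * MvPolynomial.homogeneousComponent b g := by
  classical
  rw [MvPolynomial.mem_pow_idealOfVars_iff'] at hh hg
  ext x
  rw [MvPolynomial.coeff_homogeneousComponent, MvPolynomial.coeff_mul, MvPolynomial.coeff_mul]
  rw [show (if x.degree = a + b then ∑ y ∈ Finset.HasAntidiagonal.antidiagonal x, h.coeff y.1 * g.coeff y.2 else 0) =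
      ∑ y ∈ Finset.HasAntidiagonal.antidiagonal x, if x.degree = a + b then h.coeff y.1 * g.coeff y.2 else 0 by
    split_ifs <;> simp]
  apply Finset.sum_congr rfl
  rintro ⟨u, v⟩ huv
  rw [Finset.HasAntidiagonal.mem_antidiagonal] at huv
  have hd : x.degree = u.degree + v.degree := by rw [← huv]; simp
  simp only [MvPolynomial.coeff_homogeneousComponent]
  by_cases h1 : u.degree < a
  · simp [hh u h1]
  by_cases h2 : v.degree < b
  · simp [hg v h2]
  by_cases h3 : u.degree = a
  · by_cases h4 : v.degree = b
    · simp [hd, h3, h4]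
    · have : x.degree ≠ a + b := by omega
      simp [h4, this]
  · have : x.degree ≠ a + b := by omega
    simp [h3, this]

/-- For a Rees algebra `G = R[f₁W^{n₁},…,f_sW^{n_s}]` over `R = k[X₁,…,X_d]` with
`fᵢ ∈ 𝔪^{nᵢ}`, the ideal generated by all initial forms `In_k(h)`, `h ∈ I_k`, `k ≥ 1`, equals
the ideal generated by the initial forms `In_{nᵢ}(fᵢ)` of the generators. -/
theorem ideal_of_initial_forms_eq_span_of_generators
    {k : Type*} [Field k] (d s : ℕ) (f : Fin s → MvPolynomial (Fin d) k)
    (n : Fin s → ℕ) (hn : ∀ i, 0 < n i)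
    (𝔪 : Ideal (MvPolynomial (Fin d) k))
    (h𝔪 : 𝔪 = Ideal.span (Set.range MvPolynomial.X))
    (hf : ∀ i, f i ∈ 𝔪 ^ n i)
    (G : Subalgebra (MvPolynomial (Fin d) k) (MvPolynomial (Fin d) k)[X])
    (hG : G = Algebra.adjoin (MvPolynomial (Fin d) k)
        {p : (MvPolynomial (Fin d) k)[X] | ∃ i, p = C (f i) * X ^ n i})
    (I : ℕ → Submodule (MvPolynomial (Fin d) k) (MvPolynomial (Fin d) k))
    (hI : ∀ j, I j = Submodule.map (lcoeff (MvPolynomial (Fin d) k) j) G.toSubmodule) :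
    Ideal.span {q : MvPolynomial (Fin d) k |
        ∃ j, 1 ≤ j ∧ ∃ h ∈ I j, q = MvPolynomial.homogeneousComponent j h} =
      Ideal.span {q : MvPolynomial (Fin d) k |
        ∃ i, q = MvPolynomial.homogeneousComponent (n i) (f i)} := by
  subst h𝔪
  have key : ∀ p ∈ G, ∀ j, p.coeff j ∈ MvPolynomial.idealOfVars (Fin d) k ^ j ∧
      (1 ≤ j → MvPolynomial.homogeneousComponent j (p.coeff j) ∈
        Ideal.span {q : MvPolynomial (Fin d) k |
        ∃ i, q = MvPolynomial.homogeneousComponent (n i) (f i)}) := by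
    intro p hp
    rw [hG] at hp
    induction hp using Algebra.adjoin_induction with
    | mem p hp =>
      obtain ⟨i, rfl⟩ := hp
      intro j
      rw [coeff_C_mul_X_pow]
      split_ifs with hj
      · subst hj
        exact ⟨hf i, fun _ => Ideal.subset_span ⟨i, rfl⟩⟩
      · simp
    | algebraMap r =>
      intro j
      rw [Polynomial.algebraMap_apply, Algebra.algebraMap_self_apply, coeff_C]
      split_ifs with hj
      · subst hj
        simp
      · simp
    | add p q _ _ ihp ihq =>
      intro j
      rw [coeff_add, map_add]
      exact ⟨add_mem (ihp j).1 (ihq j).1, fun h => add_mem ((ihp j).2 h) ((ihq j).2 h)⟩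
    | mul p q _ _ ihp ihq =>
      intro j
      rw [coeff_mul, map_sum]
      refine ⟨sum_mem ?_, fun h => sum_mem ?_⟩
      · rintro ⟨a, b⟩ hab
        rw [Finset.HasAntidiagonal.mem_antidiagonal] at hab
        subst hab
        rw [pow_add]
        exact Ideal.mul_mem_mul (ihp a).1 (ihq b).1
      · rintro ⟨a, b⟩ hab
        rw [Finset.HasAntidiagonal.mem_antidiagonal] at hab
        subst hab
        simp only at h ⊢
        rw [hc_mul_aux (ihp a).1 (ihq b).1]
        rcases Nat.eq_zero_or_pos a with ha | ha
        · exact Ideal.mul_mem_left _ _ ((ihq b).2 (by omega))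
        · exact Ideal.mul_mem_right _ _ ((ihp a).2 ha)
  apply le_antisymm
  · rw [Ideal.span_le]
    rintro _ ⟨j, hj, h, hh, rfl⟩
    rw [hI] at hh
    obtain ⟨p, hp, rfl⟩ := hh
    exact (key p hp j).2 hj
  · rw [Ideal.span_le]
    rintro _ ⟨i, rfl⟩
    refine Ideal.subset_span ⟨n i, hn i, f i, ?_, rfl⟩
    rw [hI]
    refine ⟨C (f i) * X ^ n i, ?_, by simp⟩
    rw [hG]
    exact Algebra.subset_adjoin ⟨i, rfl⟩
end

section
/- Let k be a field, R = k[X₁,…,X_d], m = (X₁,…,X_d), N a positive integer, and I an ideal of R with I ⊆ m^N. Then the ideal of R generated by the initial forms {In_{mN}(h) : m ≥ 1, h ∈ I^m} equals the ideal generated by {In_N(h) : h ∈ I}. (The ideal of initial forms of the Rees ring R[I·W^N] is generated by the initial forms of I in degree N.) -/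
open MvPolynomial in
theorem homogComp_mul_aux {k : Type*} [Field k] {d i j : ℕ} {a b : MvPolynomial (Fin d) k}
    (ha : a ∈ idealOfVars (Fin d) k ^ i) (hb : b ∈ idealOfVars (Fin d) k ^ j) :
    homogeneousComponent (i + j) (a * b) =
      homogeneousComponent i a * homogeneousComponent j b := by
  classical
  rw [mem_pow_idealOfVars_iff'] at ha hb
  ext n
  rw [coeff_homogeneousComponent, coeff_mul, coeff_mul]
  by_cases hn : n.degree = i + j
  · rw [if_pos hn]
    refine Finset.sum_congr rfl fun x hx => ?_
    rw [Finset.HasAntidiagonal.mem_antidiagonal] at hx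
    rw [← hx, map_add] at hn
    rw [coeff_homogeneousComponent, coeff_homogeneousComponent]
    rcases lt_trichotomy x.1.degree i with h | h | h
    · simp [ha _ h]
    · have h2 : x.2.degree = j := by omega
      simp [h, h2]
    · have h2 : x.2.degree < j := by omega
      simp [hb _ h2]
  · rw [if_neg hn]
    refine (Finset.sum_eq_zero fun x hx => ?_).symm
    rw [Finset.HasAntidiagonal.mem_antidiagonal] at hx
    rw [← hx, map_add] at hn
    rw [coeff_homogeneousComponent, coeff_homogeneousComponent]
    by_cases h : x.1.degree = i
    · have h2 : x.2.degree ≠ j := by omega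
      simp [h2]
    · simp [h]


/-- For an ideal `I ⊆ 𝔪^N` of `R = k[X₁,…,X_d]`, the ideal generated by the
initial forms `In_{tN}(h)` for `h ∈ I^t`, `t ≥ 1`, equals the ideal generated by the initial
forms `In_N(h)` for `h ∈ I` (the ideal of initial forms of the Rees ring `R[I·W^N]` is
generated in degree `N`). -/
theorem initial_forms_of_powers_eq_initial_forms
    {k : Type*} [Field k] (d N : ℕ) (hN : 0 < N)
    (𝔪 I : Ideal (MvPolynomial (Fin d) k))
    (h𝔪 : 𝔪 = Ideal.span (Set.range MvPolynomial.X))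
    (hI : I ≤ 𝔪 ^ N) :
    Ideal.span {q : MvPolynomial (Fin d) k |
        ∃ t, 1 ≤ t ∧ ∃ h ∈ I ^ t, q = MvPolynomial.homogeneousComponent (t * N) h} =
      Ideal.span {q : MvPolynomial (Fin d) k |
        ∃ h ∈ I, q = MvPolynomial.homogeneousComponent N h} := by
  have h𝔪' : 𝔪 = MvPolynomial.idealOfVars (Fin d) k := h𝔪
  subst h𝔪'
  apply le_antisymm
  · rw [Ideal.span_le]
    rintro q ⟨t, ht, h, hh, rfl⟩
    obtain ⟨s, rfl⟩ : ∃ s, t = s + 1 := ⟨t - 1, by omega⟩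
    rw [pow_succ] at hh
    rw [SetLike.mem_coe]
    refine Submodule.mul_induction_on hh (fun a ha b hb => ?_) (fun x y hx hy => ?_)
    · have ha' : a ∈ MvPolynomial.idealOfVars (Fin d) k ^ (s * N) := by
        rw [mul_comm, pow_mul]
        exact Ideal.pow_right_mono hI s ha
      rw [add_mul, one_mul, homogComp_mul_aux ha' (hI hb)]
      exact Ideal.mul_mem_left _ _ (Ideal.subset_span ⟨b, hb, rfl⟩)
    · rw [map_add]
      exact Ideal.add_mem _ hx hy
  · refine Ideal.span_mono ?_
    rintro q ⟨h, hh, rfl⟩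
    exact ⟨1, le_rfl, h, by simpa using hh, by rw [one_mul]⟩
end

section
/- Let k be a field, R = k[X₁,…,X_d], m = (X₁,…,X_d), and let f₁,…,f_s ∈ R and positive integers n₁,…,n_s satisfy fᵢ ∈ m^{nᵢ} for all i. Let G = R[f₁·W^{n₁},…,f_s·W^{n_s}] ⊆ R[W] with degree parts I_k, and let N be a positive integer divisible by every nᵢ. Then the radical of the ideal of R generated by {In_N(h) : h ∈ I_N} equals the radical of the ideal generated by {In_{n₁}(f₁),…,In_{n_s}(f_s)}. -/
open Polynomial

theorem aux_homogeneousComponent_mul {k : Type*} [Field k] {d : ℕ}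
    (a b : MvPolynomial (Fin d) k) (i j : ℕ)
    (ha : a ∈ MvPolynomial.idealOfVars (Fin d) k ^ i)
    (hb : b ∈ MvPolynomial.idealOfVars (Fin d) k ^ j) :
    MvPolynomial.homogeneousComponent (i + j) (a * b) =
      MvPolynomial.homogeneousComponent i a * MvPolynomial.homogeneousComponent j b := by
  classical
  rw [MvPolynomial.mem_pow_idealOfVars_iff'] at ha hb
  ext m
  rw [MvPolynomial.coeff_homogeneousComponent, MvPolynomial.coeff_mul, MvPolynomial.coeff_mul]
  split_ifs with hm
  · refine Finset.sum_congr rfl fun x hx => ?_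
    rw [Finset.HasAntidiagonal.mem_antidiagonal] at hx
    have hd : x.1.degree + x.2.degree = i + j := by rw [← hm, ← hx, map_add]
    simp only [MvPolynomial.coeff_homogeneousComponent]
    rcases lt_trichotomy x.1.degree i with h | h | h
    · simp [ha _ h, h.ne]
    · have h2 : x.2.degree = j := by omega
      simp [h, h2]
    · have h2 : x.2.degree < j := by omega
      simp [hb _ h2, h2.ne]
  · symm
    refine Finset.sum_eq_zero fun x hx => ?_
    rw [Finset.HasAntidiagonal.mem_antidiagonal] at hx
    have hd : x.1.degree + x.2.degree = m.degree := by rw [← hx, map_add]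
    simp only [MvPolynomial.coeff_homogeneousComponent]
    by_cases h : x.1.degree = i
    · have h2 : x.2.degree ≠ j := by omega
      simp [h2]
    · simp [h]

theorem aux_homogeneousComponent_pow {k : Type*} [Field k] {d : ℕ}
    (a : MvPolynomial (Fin d) k) (i : ℕ)
    (ha : a ∈ MvPolynomial.idealOfVars (Fin d) k ^ i) (t : ℕ) :
    MvPolynomial.homogeneousComponent (i * t) (a ^ t) =
      MvPolynomial.homogeneousComponent i a ^ t := by
  induction t with
  | zero => simp [MvPolynomial.homogeneousComponent_zero]
  | succ t ih =>
    rw [pow_succ, pow_succ, ← ih, mul_add_one, aux_homogeneousComponent_mul _ _ _ _ _ ha]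
    rw [pow_mul]
    exact Ideal.pow_mem_pow ha t

/-- For a Rees algebra `G = R[f₁W^{n₁},…,f_sW^{n_s}]` over `R = k[X₁,…,X_d]` with
`fᵢ ∈ 𝔪^{nᵢ}`, and `N` a positive common multiple of the `nᵢ`, the radical of the ideal
generated by the initial forms `In_N(h)`, `h ∈ I_N`, equals the radical of the ideal generated
by the initial forms `In_{nᵢ}(fᵢ)` of the generators. -/
theorem radical_initial_forms_of_graded_piece
    {k : Type*} [Field k] (d s : ℕ) (f : Fin s → MvPolynomial (Fin d) k)
    (n : Fin s → ℕ) (hn : ∀ i, 0 < n i)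
    (𝔪 : Ideal (MvPolynomial (Fin d) k))
    (h𝔪 : 𝔪 = Ideal.span (Set.range MvPolynomial.X))
    (hf : ∀ i, f i ∈ 𝔪 ^ n i)
    (G : Subalgebra (MvPolynomial (Fin d) k) (MvPolynomial (Fin d) k)[X])
    (hG : G = Algebra.adjoin (MvPolynomial (Fin d) k)
        {p : (MvPolynomial (Fin d) k)[X] | ∃ i, p = C (f i) * X ^ n i})
    (N : ℕ) (hN : 0 < N) (hdvd : ∀ i, n i ∣ N)
    (I_N : Submodule (MvPolynomial (Fin d) k) (MvPolynomial (Fin d) k))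
    (hI : I_N = Submodule.map (lcoeff (MvPolynomial (Fin d) k) N) G.toSubmodule) :
    (Ideal.span {q : MvPolynomial (Fin d) k |
        ∃ h ∈ I_N, q = MvPolynomial.homogeneousComponent N h}).radical =
      (Ideal.span {q : MvPolynomial (Fin d) k |
        ∃ i, q = MvPolynomial.homogeneousComponent (n i) (f i)}).radical := by
  change 𝔪 = MvPolynomial.idealOfVars (Fin d) k at h𝔪
  subst h𝔪
  subst hG
  subst hI
  apply le_antisymm
  · apply Ideal.radical_mono
    rw [Ideal.span_le]
    rintro _ ⟨h, ⟨p, hp, rfl⟩, rfl⟩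
    set J := Ideal.span {q : MvPolynomial (Fin d) k |
        ∃ i, q = MvPolynomial.homogeneousComponent (n i) (f i)} with hJ
    have key : ∀ j, p.coeff j ∈ MvPolynomial.idealOfVars (Fin d) k ^ j ∧
        (0 < j → MvPolynomial.homogeneousComponent j (p.coeff j) ∈ J) := by
      have hp' : p ∈ Algebra.adjoin (MvPolynomial (Fin d) k)
        {p : (MvPolynomial (Fin d) k)[X] | ∃ i, p = C (f i) * X ^ n i} := hp
      clear hp
      induction hp' using Algebra.adjoin_induction with
      | mem x hx =>
        obtain ⟨i, rfl⟩ := hx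
        intro j
        rw [coeff_C_mul_X_pow]
        split_ifs with h
        · subst h
          exact ⟨hf i, fun _ => Ideal.subset_span ⟨i, rfl⟩⟩
        · simp
      | algebraMap r =>
        intro j
        rw [← C_eq_algebraMap, coeff_C]
        split_ifs with h
        · subst h
          simp
        · simp
      | add x y _ _ hx hy =>
        intro j
        rw [coeff_add, map_add]
        exact ⟨add_mem (hx j).1 (hy j).1, fun h => add_mem ((hx j).2 h) ((hy j).2 h)⟩
      | mul x y _ _ hx hy =>
        intro j
        rw [coeff_mul, map_sum]
        refine ⟨sum_mem fun c hc => ?_, fun h => sum_mem fun c hc => ?_⟩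
        · rw [Finset.HasAntidiagonal.mem_antidiagonal] at hc
          rw [← hc, pow_add]
          exact Ideal.mul_mem_mul (hx _).1 (hy _).1
        · rw [Finset.HasAntidiagonal.mem_antidiagonal] at hc
          rw [← hc, aux_homogeneousComponent_mul _ _ _ _ (hx _).1 (hy _).1]
          rcases Nat.eq_zero_or_pos c.1 with h0 | h0
          · exact Ideal.mul_mem_left _ _ ((hy _).2 (by omega))
          · exact Ideal.mul_mem_right _ _ ((hx _).2 h0)
    exact (key N).2 hN
  · rw [Ideal.radical_le_radical_iff, Ideal.span_le]
    rintro _ ⟨i, rfl⟩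
    obtain ⟨t, ht⟩ := hdvd i
    refine ⟨t, Ideal.subset_span ⟨f i ^ t, ?_, ?_⟩⟩
    · refine ⟨(C (f i) * X ^ n i) ^ t, ?_, ?_⟩
      · exact Subalgebra.pow_mem _ (Algebra.subset_adjoin (by exact ⟨i, rfl⟩)) t
      · rw [mul_pow, ← C_pow, ← pow_mul, ← ht, lcoeff_apply, coeff_C_mul_X_pow]
        simp
    · rw [ht, aux_homogeneousComponent_pow _ _ (hf i)]
end

section
/- Let k be a field, R = k[X₁,…,X_d], m = (X₁,…,X_d), N a positive integer, and I an ideal of R with I ⊆ m^N. Suppose h ∈ R satisfies an equation of integral dependence over I, i.e. h^t + a₁·h^{t−1} + ⋯ + a_t = 0 for some t ≥ 1 with aⱼ ∈ I^j for each j. Then h ∈ m^N, and the initial form In_N(h) lies in the radical of the ideal of R generated by {In_N(a) : a ∈ I}. -/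
open MvPolynomial in
theorem aux_hc_zero {k : Type*} [Field k] {d : ℕ} {p n : ℕ} (hn : n < p)
    {f : MvPolynomial (Fin d) k} (hf : f ∈ idealOfVars (Fin d) k ^ p) :
    homogeneousComponent n f = 0 := by
  classical
  rw [mem_pow_idealOfVars_iff'] at hf
  ext x
  rw [coeff_homogeneousComponent]
  split_ifs with h
  · rw [hf x (by omega)]; simp
  · simp

open MvPolynomial in
theorem aux_mem_succ {k : Type*} [Field k] {d : ℕ} {p : ℕ}
    {f : MvPolynomial (Fin d) k} (hf : f ∈ idealOfVars (Fin d) k ^ p)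
    (h0 : homogeneousComponent p f = 0) : f ∈ idealOfVars (Fin d) k ^ (p + 1) := by
  classical
  rw [mem_pow_idealOfVars_iff'] at hf ⊢
  intro x hx
  by_cases h : x.degree < p
  · exact hf x h
  · have h1 := coeff_homogeneousComponent p f x
    rw [h0, if_pos (by omega)] at h1
    simpa using h1.symm

open MvPolynomial in
theorem aux_hc_mem {k : Type*} [Field k] {d : ℕ} (p : ℕ)
    (f : MvPolynomial (Fin d) k) :
    homogeneousComponent p f ∈ idealOfVars (Fin d) k ^ p := by
  classical
  rw [mem_pow_idealOfVars_iff']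
  intro x hx
  rw [coeff_homogeneousComponent, if_neg (by omega)]

open MvPolynomial in
theorem aux_hc_hc {k : Type*} [Field k] {d : ℕ} (p : ℕ)
    (f : MvPolynomial (Fin d) k) :
    homogeneousComponent p (homogeneousComponent p f) = homogeneousComponent p f :=
  homogeneousComponent_eq_self (homogeneousComponent_isHomogeneous p f)

open MvPolynomial in
theorem aux_sub {k : Type*} [Field k] {d : ℕ} {p : ℕ}
    {f : MvPolynomial (Fin d) k} (hf : f ∈ idealOfVars (Fin d) k ^ p) :
    f - homogeneousComponent p f ∈ idealOfVars (Fin d) k ^ (p + 1) := by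
  apply aux_mem_succ (sub_mem hf (aux_hc_mem p f))
  rw [map_sub, aux_hc_hc, sub_self]

open MvPolynomial in
theorem aux_hc_mul {k : Type*} [Field k] {d : ℕ} {p q : ℕ}
    {f g : MvPolynomial (Fin d) k} (hf : f ∈ idealOfVars (Fin d) k ^ p)
    (hg : g ∈ idealOfVars (Fin d) k ^ q) :
    homogeneousComponent (p + q) (f * g) =
      homogeneousComponent p f * homogeneousComponent q g := by
  have e : f * g = homogeneousComponent p f * homogeneousComponent q g +
      ((f - homogeneousComponent p f) * g +
        homogeneousComponent p f * (g - homogeneousComponent q g)) := by ring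
  have h1 : (f - homogeneousComponent p f) * g ∈ idealOfVars (Fin d) k ^ (p + 1 + q) := by
    rw [pow_add]; exact Ideal.mul_mem_mul (aux_sub hf) hg
  have h2 : homogeneousComponent p f * (g - homogeneousComponent q g) ∈
      idealOfVars (Fin d) k ^ (p + (q + 1)) := by
    rw [pow_add]; exact Ideal.mul_mem_mul (aux_hc_mem p f) (aux_sub hg)
  rw [e, map_add, map_add, aux_hc_zero (by omega) h1, aux_hc_zero (by omega) h2, add_zero,
    add_zero]
  exact homogeneousComponent_eq_self
    ((homogeneousComponent_isHomogeneous p f).mul (homogeneousComponent_isHomogeneous q g))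

open MvPolynomial in
theorem aux_hc_pow {k : Type*} [Field k] {d : ℕ} {p : ℕ}
    {f : MvPolynomial (Fin d) k} (hf : f ∈ idealOfVars (Fin d) k ^ p) (n : ℕ) :
    homogeneousComponent (p * n) (f ^ n) = homogeneousComponent p f ^ n := by
  induction n with
  | zero => exact homogeneousComponent_eq_self (by simpa using isHomogeneous_one (Fin d) k)
  | succ n ih =>
    have : f ^ n ∈ idealOfVars (Fin d) k ^ (p * n) := by
      rw [pow_mul]; exact Ideal.pow_mem_pow hf n
    rw [pow_succ, Nat.mul_succ, aux_hc_mul this hf, ih, pow_succ]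

/-- If `h` satisfies an equation of integral dependence
`h^t + a₁h^{t-1} + ⋯ + a_t = 0` over an ideal `I ⊆ 𝔪^N` of `R = k[X₁,…,X_d]` (with `aⱼ ∈ Iʲ`),
then `h ∈ 𝔪^N` and the initial form `In_N(h)` lies in the radical of the ideal generated by
the initial forms `In_N(a)`, `a ∈ I`. -/
theorem initial_form_of_integral_element
    {k : Type*} [Field k] (d N : ℕ) (hN : 0 < N)
    (𝔪 I : Ideal (MvPolynomial (Fin d) k))
    (h𝔪 : 𝔪 = Ideal.span (Set.range MvPolynomial.X))
    (hI : I ≤ 𝔪 ^ N)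
    (h : MvPolynomial (Fin d) k) (t : ℕ) (ht : 1 ≤ t)
    (a : Fin t → MvPolynomial (Fin d) k)
    (ha : ∀ j : Fin t, a j ∈ I ^ ((j : ℕ) + 1))
    (heq : h ^ t + ∑ j : Fin t, a j * h ^ (t - ((j : ℕ) + 1)) = 0) :
    h ∈ 𝔪 ^ N ∧
      MvPolynomial.homogeneousComponent N h ∈
        (Ideal.span {q : MvPolynomial (Fin d) k |
          ∃ b ∈ I, q = MvPolynomial.homogeneousComponent N b}).radical := by
  subst h𝔪
  change I ≤ MvPolynomial.idealOfVars (Fin d) k ^ N at hI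
  change h ∈ MvPolynomial.idealOfVars (Fin d) k ^ N ∧ _
  have haI : ∀ n, I ^ n ≤ MvPolynomial.idealOfVars (Fin d) k ^ (N * n) := fun n => by
    rw [pow_mul]; exact Ideal.pow_right_mono hI n
  have heq' : h ^ t = -∑ j : Fin t, a j * h ^ (t - ((j : ℕ) + 1)) :=
    eq_neg_of_add_eq_zero_left heq
  have hpow : ∀ s n, h ∈ MvPolynomial.idealOfVars (Fin d) k ^ s →
      h ^ n ∈ MvPolynomial.idealOfVars (Fin d) k ^ (s * n) := fun s n hs => by
    rw [pow_mul]; exact Ideal.pow_mem_pow hs n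
  have key : ∀ s, s ≤ N → h ∈ MvPolynomial.idealOfVars (Fin d) k ^ s := by
    intro s
    induction s with
    | zero => intro _; simp
    | succ s ih =>
      intro hs
      have hm := ih (by omega)
      apply aux_mem_succ hm
      have h1 : h ^ t ∈ MvPolynomial.idealOfVars (Fin d) k ^ (s * t + 1) := by
        rw [heq']
        refine neg_mem (sum_mem fun j _ => ?_)
        have hj := Ideal.mul_mem_mul (haI _ (ha j)) (hpow s (t - ((j : ℕ) + 1)) hm)
        rw [← pow_add] at hj
        refine Ideal.pow_le_pow_right ?_ hj
        obtain ⟨c, hc⟩ : ∃ c, t = (j : ℕ) + 1 + c := ⟨t - (j + 1), by omega⟩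
        rw [show t - ((j : ℕ) + 1) = c by omega]
        have h3 : (s + 1) * ((j : ℕ) + 1) ≤ N * ((j : ℕ) + 1) := Nat.mul_le_mul_right _ hs
        have h4 : s * t = s * ((j : ℕ) + 1) + s * c := by rw [← Nat.mul_add, ← hc]
        have h5 : (s + 1) * ((j : ℕ) + 1) = s * ((j : ℕ) + 1) + ((j : ℕ) + 1) := by ring
        omega
      have h2 := aux_hc_pow hm t
      rw [aux_hc_zero (by omega) h1] at h2
      exact eq_zero_of_pow_eq_zero h2.symm
  have hm := key N le_rfl
  refine ⟨hm, t, ?_⟩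
  rw [← aux_hc_pow hm t, heq', map_neg, map_sum]
  refine neg_mem (sum_mem fun j _ => ?_)
  have e : N * t = N * ((j : ℕ) + 1) + N * (t - ((j : ℕ) + 1)) := by
    rw [← Nat.mul_add]; congr 1; omega
  rw [e, aux_hc_mul (haI _ (ha j)) (hpow N _ hm)]
  apply Ideal.mul_mem_right
  have haj := ha j
  rw [pow_succ] at haj
  refine Submodule.mul_induction_on haj ?_ ?_
  · intro u hu v hv
    rw [Nat.mul_succ, aux_hc_mul (haI _ hu) (hI hv)]
    exact Ideal.mul_mem_left _ _ (Ideal.subset_span ⟨v, hv, rfl⟩)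
  · intro x y hx hy
    rw [map_add]
    exact add_mem hx hy
end

section
/- Let k be a field, R = k[X₁,…,X_d], m = (X₁,…,X_d). Let G = R[f₁·W^{n₁},…,f_s·W^{n_s}] and G' = R[g₁·W^{m₁},…,g_t·W^{m_t}] be Rees algebras in R[W] with fᵢ ∈ m^{nᵢ} for all i and gⱼ ∈ m^{mⱼ} for all j, and suppose G and G' have the same integral closure inside R[W] (they are integrally equivalent). Then the radical of the ideal of R generated by {In_{n₁}(f₁),…,In_{n_s}(f_s)} equals the radical of the ideal generated by {In_{m₁}(g₁),…,In_{m_t}(g_t)}. (Consequently the ideals of initial forms of G and G' at the origin define the same tangent cone as a set, the same linear space of vertices, and hence the same τ-invariant.) -/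
open Polynomial

namespace InitForms

lemma hc_mul {k : Type*} [Field k] {d : ℕ} {i j : ℕ} {a b : MvPolynomial (Fin d) k}
    (ha : a ∈ MvPolynomial.idealOfVars (Fin d) k ^ i)
    (hb : b ∈ MvPolynomial.idealOfVars (Fin d) k ^ j) :
    MvPolynomial.homogeneousComponent (i + j) (a * b) =
      MvPolynomial.homogeneousComponent i a * MvPolynomial.homogeneousComponent j b := by
  classical
  rw [MvPolynomial.mem_pow_idealOfVars_iff'] at ha hb
  ext e
  rw [MvPolynomial.coeff_homogeneousComponent, MvPolynomial.coeff_mul, MvPolynomial.coeff_mul]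
  simp only [MvPolynomial.coeff_homogeneousComponent]
  split_ifs with he
  · refine Finset.sum_congr rfl fun x hx => ?_
    have hx' := Finset.HasAntidiagonal.mem_antidiagonal.1 hx
    have hdeg : x.1.degree + x.2.degree = i + j := by
      rw [← he, ← hx', map_add]
    by_cases h1 : x.1.degree < i
    · rw [ha _ h1]; simp
    by_cases h2 : x.2.degree < j
    · rw [hb _ h2]; simp
    rw [if_pos (by omega), if_pos (by omega)]
  · symm
    refine Finset.sum_eq_zero fun x hx => ?_
    have hx' := Finset.HasAntidiagonal.mem_antidiagonal.1 hx
    by_cases h1 : x.1.degree = i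
    · by_cases h2 : x.2.degree = j
      · exact absurd (by rw [← hx', map_add, h1, h2]) he
      · simp [h2]
    · simp [h1]

/-- the initial form map -/
noncomputable def inFun {k : Type*} [Field k] {d : ℕ} (p : (MvPolynomial (Fin d) k)[X]) :
    (MvPolynomial (Fin d) k)[X] :=
  p.sum fun n a => monomial n (MvPolynomial.homogeneousComponent n a)

lemma coeff_inFun {k : Type*} [Field k] {d : ℕ} (p : (MvPolynomial (Fin d) k)[X]) (n : ℕ) :
    (inFun p).coeff n = MvPolynomial.homogeneousComponent n (p.coeff n) := by
  simp only [inFun, Polynomial.sum, finsetSum_coeff, coeff_monomial]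
  rw [Finset.sum_ite_eq']
  split_ifs with h
  · rfl
  · rw [notMem_support_iff.1 h, map_zero]

/-- the initial form map as a ring hom -/
noncomputable def inHom (k : Type*) [Field k] (d : ℕ) :
    reesAlgebra (MvPolynomial.idealOfVars (Fin d) k) →+* (MvPolynomial (Fin d) k)[X] where
  toFun p := inFun p.1
  map_one' := by
    ext1 n
    rw [coeff_inFun]
    simp only [OneMemClass.coe_one, coeff_one]
    split_ifs with h
    · subst h
      simp [MvPolynomial.homogeneousComponent_zero]
    · simp
  map_zero' := by
    ext1 n
    rw [coeff_inFun]
    simp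
  map_add' p q := by
    ext1 n
    rw [coeff_add, coeff_inFun, coeff_inFun, coeff_inFun]
    simp
  map_mul' p q := by
    ext1 n
    rw [coeff_mul, coeff_inFun]
    simp only [MulMemClass.coe_mul, coeff_mul, map_sum, coeff_inFun]
    refine Finset.sum_congr rfl fun x hx => ?_
    rw [← Finset.HasAntidiagonal.mem_antidiagonal.1 hx]
    exact hc_mul (p.2 _) (q.2 _)

lemma key {k : Type*} [Field k] (d s : ℕ)
    (f : Fin s → MvPolynomial (Fin d) k) (n : Fin s → ℕ) 
    (hf : ∀ i, f i ∈ MvPolynomial.idealOfVars (Fin d) k ^ n i)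
    (g : MvPolynomial (Fin d) k) (m : ℕ) (hm : 0 < m)
    (hg : g ∈ MvPolynomial.idealOfVars (Fin d) k ^ m)
    (G : Subalgebra (MvPolynomial (Fin d) k) (MvPolynomial (Fin d) k)[X])
    (hG : G = Algebra.adjoin (MvPolynomial (Fin d) k)
        {p : (MvPolynomial (Fin d) k)[X] | ∃ i, p = C (f i) * X ^ n i})
    (hint : IsIntegral G (C g * X ^ m : (MvPolynomial (Fin d) k)[X])) :
    MvPolynomial.homogeneousComponent m g ∈ (Ideal.span {q : MvPolynomial (Fin d) k |
        ∃ i, q = MvPolynomial.homogeneousComponent (n i) (f i)}).radical := by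
  rw [Ideal.radical_eq_sInf, Submodule.mem_sInf]
  rintro P ⟨hJP, hP⟩
  by_contra hgP
  set S := reesAlgebra (MvPolynomial.idealOfVars (Fin d) k) with hS
  have hGS : G ≤ S := by
    rw [hG, Algebra.adjoin_le_iff]
    rintro _ ⟨i, rfl⟩
    rw [C_mul_X_pow_eq_monomial]
    exact reesAlgebra.monomial_mem.2 (hf i)
  have hxS : (C g * X ^ m : (MvPolynomial (Fin d) k)[X]) ∈ S := by
    rw [C_mul_X_pow_eq_monomial]
    exact reesAlgebra.monomial_mem.2 hg
  let φ : S →+* (MvPolynomial (Fin d) k ⧸ P)[X] :=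
    (mapRingHom (Ideal.Quotient.mk P)).comp (inHom k d)
  have hφ : ∀ (x : S) (j : ℕ), (φ x).coeff j =
      Ideal.Quotient.mk P (MvPolynomial.homogeneousComponent j (x.1.coeff j)) := by
    intro x j
    change ((inFun x.1).map (Ideal.Quotient.mk P)).coeff j = _
    rw [coeff_map, coeff_inFun]
  have hmono : ∀ (a : MvPolynomial (Fin d) k) (j : ℕ) (h : C a * X ^ j ∈ S),
      φ ⟨C a * X ^ j, h⟩ =
        monomial j (Ideal.Quotient.mk P (MvPolynomial.homogeneousComponent j a)) := by
    intro a j h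
    ext1 l
    rw [hφ, coeff_monomial]
    simp only [C_mul_X_pow_eq_monomial, coeff_monomial]
    split_ifs with hjl
    · rw [hjl]
    · simp
  let c0 : k →+* MvPolynomial (Fin d) k ⧸ P := (Ideal.Quotient.mk P).comp MvPolynomial.C
  let c : k →+* (MvPolynomial (Fin d) k ⧸ P)[X] := C.comp c0
  have hc : ∀ x (h : x ∈ G), φ ⟨x, hGS h⟩ ∈ c.range := by
    intro x h
    have h' := h
    rw [hG] at h'
    suffices ∃ h : x ∈ S, φ ⟨x, h⟩ ∈ c.range from this.2
    induction h' using Algebra.adjoin_induction with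
    | mem x hx =>
      obtain ⟨i, rfl⟩ := hx
      have hS' : C (f i) * X ^ n i ∈ S := hGS (hG ▸ Algebra.subset_adjoin ⟨i, rfl⟩)
      refine ⟨hS', ?_⟩
      rw [hmono, Ideal.Quotient.eq_zero_iff_mem.2 (hJP (Ideal.subset_span ⟨i, rfl⟩))]
      simp
    | algebraMap r =>
      refine ⟨S.algebraMap_mem r, ⟨MvPolynomial.coeff 0 r, ?_⟩⟩
      have := hmono r 0 (by simpa using S.algebraMap_mem r)
      simp only [pow_zero, mul_one, MvPolynomial.homogeneousComponent_zero, monomial_zero_left]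
        at this
      exact this.symm
    | add x y hx hy ihx ihy =>
      obtain ⟨h1, h2⟩ := ihx (hG ▸ hx)
      obtain ⟨h3, h4⟩ := ihy (hG ▸ hy)
      refine ⟨S.add_mem h1 h3, ?_⟩
      have := c.range.add_mem h2 h4
      rwa [← map_add] at this
    | mul x y hx hy ihx ihy =>
      obtain ⟨h1, h2⟩ := ihx (hG ▸ hx)
      obtain ⟨h3, h4⟩ := ihy (hG ▸ hy)
      refine ⟨S.mul_mem h1 h3, ?_⟩
      have := c.range.mul_mem h2 h4
      rwa [← map_mul] at this
  obtain ⟨q, hq, hq0⟩ := hint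
  let ι : G →+* S := (Subalgebra.inclusion hGS).toRingHom
  have e1 : eval₂ ι (⟨_, hxS⟩ : S) q = 0 := by
    apply Subtype.val_injective
    have := hom_eval₂ q ι S.val.toRingHom ⟨_, hxS⟩
    exact this.trans hq0
  have e2 : eval₂ (φ.comp ι) (φ ⟨_, hxS⟩) q = 0 := by
    rw [← hom_eval₂, e1, map_zero]
  have hl : q.map (φ.comp ι) ∈ lifts c := by
    rw [lifts_iff_coeff_lifts]
    intro l
    rw [coeff_map]
    exact hc _ (q.coeff l).2
  obtain ⟨r, hr, -, hrm⟩ := lifts_and_degree_eq_and_monic hl (hq.map _)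
  have e3 : (r.map c0).comp (φ ⟨_, hxS⟩) = 0 := by
    rw [comp, eval₂_map]
    rw [eval₂_eq_eval_map, ← hr, ← eval₂_eq_eval_map] at e2
    exact e2
  have hb : Ideal.Quotient.mk P (MvPolynomial.homogeneousComponent m g) ≠ 0 := fun h =>
    hgP (Ideal.Quotient.eq_zero_iff_mem.1 h)
  rw [hmono] at e3
  rcases comp_eq_zero_iff.1 e3 with h | ⟨-, h⟩
  · exact (hrm.map c0).ne_zero h
  · have := congrArg (fun p => coeff p m) h
    simp [coeff_C, hm.ne'] at this
    exact hb (by simpa using this)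

end InitForms

/-- If two Rees algebras `G = R[f₁W^{n₁},…,f_sW^{n_s}]` and
`G' = R[g₁W^{m₁},…,g_tW^{m_t}]` over `R = k[X₁,…,X_d]`, with `fᵢ ∈ 𝔪^{nᵢ}` and `gⱼ ∈ 𝔪^{mⱼ}`,
have the same integral closure inside `R[W]`, then the radical of the ideal generated by the
initial forms of the `fᵢ` equals the radical of the ideal generated by the initial forms of
the `gⱼ` (hence the two Rees algebras have the same τ-invariant at the origin). -/
theorem radical_initial_forms_of_integrally_equivalent
    {k : Type*} [Field k] (d s t : ℕ)
    (f : Fin s → MvPolynomial (Fin d) k) (g : Fin t → MvPolynomial (Fin d) k)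
    (n : Fin s → ℕ) (m : Fin t → ℕ) (hn : ∀ i, 0 < n i) (hm : ∀ j, 0 < m j)
    (𝔪 : Ideal (MvPolynomial (Fin d) k))
    (h𝔪 : 𝔪 = Ideal.span (Set.range MvPolynomial.X))
    (hf : ∀ i, f i ∈ 𝔪 ^ n i) (hg : ∀ j, g j ∈ 𝔪 ^ m j)
    (G G' : Subalgebra (MvPolynomial (Fin d) k) (MvPolynomial (Fin d) k)[X])
    (hG : G = Algebra.adjoin (MvPolynomial (Fin d) k)
        {p : (MvPolynomial (Fin d) k)[X] | ∃ i, p = C (f i) * X ^ n i})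
    (hG' : G' = Algebra.adjoin (MvPolynomial (Fin d) k)
        {p : (MvPolynomial (Fin d) k)[X] | ∃ j, p = C (g j) * X ^ m j})
    (hclosure : (integralClosure G (MvPolynomial (Fin d) k)[X] : Set (MvPolynomial (Fin d) k)[X])
        = (integralClosure G' (MvPolynomial (Fin d) k)[X] : Set (MvPolynomial (Fin d) k)[X])) :
    (Ideal.span {q : MvPolynomial (Fin d) k |
        ∃ i, q = MvPolynomial.homogeneousComponent (n i) (f i)}).radical =
      (Ideal.span {q : MvPolynomial (Fin d) k |
        ∃ j, q = MvPolynomial.homogeneousComponent (m j) (g j)}).radical := by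
  have h𝔪' : 𝔪 = MvPolynomial.idealOfVars (Fin d) k := h𝔪
  rw [h𝔪'] at hf hg
  apply le_antisymm
  · refine Ideal.radical_le_radical_iff.2 (Ideal.span_le.2 ?_)
    rintro _ ⟨i, rfl⟩
    refine InitForms.key d t g m hg (f i) (n i) (hn i) (hf i) G' hG' ?_
    have h : (C (f i) * X ^ n i : (MvPolynomial (Fin d) k)[X]) ∈
        (integralClosure G (MvPolynomial (Fin d) k)[X] : Set (MvPolynomial (Fin d) k)[X]) :=
      (integralClosure G (MvPolynomial (Fin d) k)[X]).algebraMap_mem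
        ⟨_, hG ▸ Algebra.subset_adjoin ⟨i, rfl⟩⟩
    rw [hclosure] at h
    exact h
  · refine Ideal.radical_le_radical_iff.2 (Ideal.span_le.2 ?_)
    rintro _ ⟨i, rfl⟩
    refine InitForms.key d s f n hf (g i) (m i) (hm i) (hg i) G hG ?_
    have h : (C (g i) * X ^ m i : (MvPolynomial (Fin d) k)[X]) ∈
        (integralClosure G' (MvPolynomial (Fin d) k)[X] : Set (MvPolynomial (Fin d) k)[X]) :=
      (integralClosure G' (MvPolynomial (Fin d) k)[X]).algebraMap_mem
        ⟨_, hG' ▸ Algebra.subset_adjoin ⟨i, rfl⟩⟩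
    rw [← hclosure] at h
    exact h
end

section
/- Let k be a field, d ≥ 1, q ≥ 1, and let J' be an ideal of k[X₂,…,X_d] generated by homogeneous polynomials of positive degree. Let J be the ideal of k[X₁,…,X_d] generated by X₁^q together with the image of J' under the inclusion k[X₂,…,X_d] ⊆ k[X₁,…,X_d]. Denote by Z(J) ⊆ k^d and Z(J') ⊆ k^{d−1} the zero loci. Then the set of translation vectors preserving Z(J), namely {v ∈ k^d : w + v ∈ Z(J) for all w ∈ Z(J)}, equals {v ∈ k^d : v₁ = 0 and (v₂,…,v_d) + w' ∈ Z(J') for all w' ∈ Z(J')}. (This is the step showing that forming the join with a purely X₁-power algebra raises the τ-invariant, measured as the codimension of the linear space of vertices, by exactly one.) -/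
/-- Let `J'` be an ideal of `k[X₂,…,X_d]` generated by homogeneous polynomials of
positive degree, and let `J` be the ideal of `k[X₁,…,X_d]` generated by `X₁^q` (`q ≥ 1`)
together with the image of `J'`. (Here the variables of `k[X₁,…,X_d]` are indexed by
`Option (Fin n)`, with `none` playing the role of `X₁`, so `d = n + 1 ≥ 1`.) Then the set of
translation vectors preserving the zero locus `Z(J) ⊆ k^d` equals the set of vectors `v` with
`v₁ = 0` whose projection to the last `d-1` coordinates preserves `Z(J') ⊆ k^{d-1}`:
the linear space of vertices drops in dimension by exactly one, i.e. the τ-invariant rises by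
one when joining with a purely `X₁`-power algebra. -/
theorem vertices_of_join_with_power_of_first_variable
    {k : Type*} [Field k] (n q : ℕ) (hq : 1 ≤ q)
    (J' : Ideal (MvPolynomial (Fin n) k))
    (hJ' : ∃ T : Set (MvPolynomial (Fin n) k),
        (∀ p ∈ T, ∃ j, 0 < j ∧ MvPolynomial.IsHomogeneous p j) ∧ J' = Ideal.span T)
    (J : Ideal (MvPolynomial (Option (Fin n)) k))
    (hJ : J = Ideal.span ({MvPolynomial.X none ^ q} ∪
        (MvPolynomial.rename (some : Fin n → Option (Fin n)) ''
          (J' : Set (MvPolynomial (Fin n) k)))))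
    (ZJ : Set (Option (Fin n) → k))
    (hZJ : ZJ = {x | ∀ p ∈ J, MvPolynomial.eval x p = 0})
    (ZJ' : Set (Fin n → k))
    (hZJ' : ZJ' = {x | ∀ p ∈ J', MvPolynomial.eval x p = 0}) :
    {v : Option (Fin n) → k | ∀ w ∈ ZJ, w + v ∈ ZJ} =
      {v : Option (Fin n) → k | v none = 0 ∧
        ∀ w' ∈ ZJ', (fun i => v (some i)) + w' ∈ ZJ'} := by
  have key : ∀ x : Option (Fin n) → k, x ∈ ZJ ↔ (x none = 0 ∧ (fun i => x (some i)) ∈ ZJ') := by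
    intro x
    subst hZJ hZJ' hJ
    simp only [Set.mem_setOf_eq]
    constructor
    · intro h
      constructor
      · have h1 := h (MvPolynomial.X none ^ q) (Ideal.subset_span (Or.inl rfl))
        rw [map_pow, MvPolynomial.eval_X] at h1
        exact eq_zero_of_pow_eq_zero h1
      · intro p hp
        have h1 := h _ (Ideal.subset_span (Or.inr ⟨p, hp, rfl⟩))
        rw [MvPolynomial.eval_rename] at h1
        exact h1
    · rintro ⟨h0, h⟩ p hp
      have hle : Ideal.span ({MvPolynomial.X none ^ q} ∪
          (MvPolynomial.rename (some : Fin n → Option (Fin n)) ''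
            (J' : Set (MvPolynomial (Fin n) k)))) ≤ RingHom.ker (MvPolynomial.eval x) := by
        rw [Ideal.span_le]
        rintro r (hr | ⟨s, hs, rfl⟩)
        · rw [Set.mem_singleton_iff] at hr
          subst hr
          rw [SetLike.mem_coe, RingHom.mem_ker, map_pow, MvPolynomial.eval_X, h0]
          exact zero_pow (by omega)
        · rw [SetLike.mem_coe, RingHom.mem_ker, MvPolynomial.eval_rename]
          exact h s hs
      exact hle hp
  have zero_mem : (0 : Fin n → k) ∈ ZJ' := by
    obtain ⟨T, hT, rfl⟩ := hJ'
    subst hZJ'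
    intro p hp
    have hle : Ideal.span T ≤ RingHom.ker (MvPolynomial.eval (0 : Fin n → k)) := by
      rw [Ideal.span_le]
      intro r hr
      obtain ⟨j, hj, hh⟩ := hT r hr
      rw [SetLike.mem_coe, RingHom.mem_ker, MvPolynomial.eval_zero,
        MvPolynomial.constantCoeff_eq]
      apply hh.coeff_eq_zero
      simp
      omega
    exact hle hp
  ext v
  simp only [Set.mem_setOf_eq]
  constructor
  · intro h
    have hv : v none = 0 := by
      have h1 := ((key _).1 (h 0 ((key 0).2 ⟨rfl, zero_mem⟩))).1
      simpa using h1
    refine ⟨hv, fun w hw => ?_⟩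
    have h1 := ((key _).1 (h (fun o => o.elim 0 w) ((key _).2 ⟨rfl, hw⟩))).2
    rw [add_comm]
    exact h1
  · rintro ⟨hv, h⟩ w hw
    obtain ⟨h0, h1⟩ := (key w).1 hw
    refine (key _).2 ⟨by simp [h0, hv], ?_⟩
    have h2 := h _ h1
    rw [add_comm] at h2
    exact h2
end
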